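/- arXiv:1912.01446 — 2 statements merged into one kernel-verified Lean document; each statement's English description precedes it below -/
import Mathlib

section
/- Let G be a discrete finitely generated group such that every subgroup of G is finitely generated. Then Sub^c_G, the set of cyclic subgroups of G, is closed in Sub_G with respect to the Chabauty topology. -/
open Topology Pointwise Filter

/-- The Chabauty space: the set of closed subgroups of `G`. -/
def CSub (G : Type*) [Group G] [TopologicalSpace G] := {H : Subgroup G // IsClosed (H : Set G)}

/-- The Chabauty topology on the space of closed subgroups, generated by the standard
sub-basis: `{A | A ∩ K = ∅}` for `K` compact and `{A | A ∩ U ≠ ∅}` for `U` open. -/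
instance CSub.topologicalSpace (G : Type*) [Group G] [TopologicalSpace G] :
    TopologicalSpace (CSub G) :=
  TopologicalSpace.generateFrom
    ({S | ∃ K : Set G, IsCompact K ∧ S = {A : CSub G | (A.1 : Set G) ∩ K = ∅}} ∪
     {S | ∃ U : Set G, IsOpen U ∧ S = {A : CSub G | ((A.1 : Set G) ∩ U).Nonempty}})

variable {G : Type*} [Group G] [TopologicalSpace G]

theorem contMulAut_zpow {T : MulAut G} (hT : Continuous ⇑T)
    (hT' : Continuous ⇑(T⁻¹ : MulAut G)) : ∀ n : ℤ, Continuous ⇑(T ^ n : MulAut G) := by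
  have hnat : ∀ (S : MulAut G), Continuous ⇑S → ∀ n : ℕ, Continuous ⇑(S ^ n : MulAut G) := by
    intro S hS n
    induction n with
    | zero => simpa [pow_zero] using (continuous_id : Continuous (id : G → G))
    | succ k ih =>
        have h : ⇑(S ^ (k + 1) : MulAut G) = ⇑(S ^ k : MulAut G) ∘ ⇑S := by
          ext x; simp [pow_succ, MulAut.mul_apply]
        rw [h]; exact ih.comp hS
  intro n
  rcases n with m | m
  · simpa using hnat T hT m
  · have h1 : (T ^ (Int.negSucc m) : MulAut G) = (T⁻¹ : MulAut G) ^ (m + 1) := by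
      rw [zpow_negSucc, inv_pow]
    rw [h1]; exact hnat _ hT' (m + 1)

/-- The homeomorphism of the Chabauty space induced by a bicontinuous automorphism. -/
def chabautyOf (T : MulAut G) (_hT : Continuous ⇑T) (hT' : Continuous ⇑(T⁻¹ : MulAut G)) :
    CSub G → CSub G := fun A =>
  ⟨A.1.map T.toMonoidHom, by
    have himg : ⇑T '' (A.1 : Set G) = ⇑(T⁻¹ : MulAut G) ⁻¹' (A.1 : Set G) := by
      ext x
      simp only [Set.mem_image, Set.mem_preimage]
      constructor
      · rintro ⟨y, hy, rfl⟩
        simpa using hy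
      · intro hx
        exact ⟨(T⁻¹ : MulAut G) x, hx, by simp⟩
    have : ((A.1.map T.toMonoidHom : Subgroup G) : Set G) = ⇑T '' (A.1 : Set G) := by
      simp [Subgroup.coe_map]
    rw [this, himg]
    exact A.2.preimage hT'⟩

/-- The action of the `n`-th power of a bicontinuous automorphism on the Chabauty space. -/
def chabautyIter (T : MulAut G) (hT : Continuous ⇑T) (hT' : Continuous ⇑(T⁻¹ : MulAut G))
    (n : ℤ) : CSub G → CSub G :=
  chabautyOf (T ^ n) (contMulAut_zpow hT hT' n)
    (by have := contMulAut_zpow hT hT' (-n); rwa [zpow_neg] at this)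

/-- The trivial subgroup `{e}` as a point of the Chabauty space. -/
def trivialCS (G : Type*) [Group G] [TopologicalSpace G] [T1Space G] : CSub G :=
  ⟨⊥, by rw [Subgroup.coe_bot]; exact isClosed_singleton⟩

/-- A sequence of integers is unbounded if the sequence of absolute values is unbounded. -/
def UnboundedZ (n : ℕ → ℤ) : Prop := ∀ C : ℕ, ∃ k, (C : ℤ) < |n k|

/-- A point of the Chabauty space which is a cyclic subgroup. -/
def IsCyclicCS (A : CSub G) : Prop := ∃ g : G, A.1 = Subgroup.zpowers g

/-- A point of the Chabauty space which is an abelian subgroup. -/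
def IsAbelianCS (A : CSub G) : Prop := ∀ x ∈ A.1, ∀ y ∈ A.1, x * y = y * x

/-- The class (NC): for every closed cyclic subgroup `A` there is no unbounded sequence
`(n_k)` in `ℤ` with `T ^ (n_k) (A) → {e}` in the Chabauty topology. -/
def ClassNC [T1Space G] (T : MulAut G) (hT : Continuous ⇑T)
    (hT' : Continuous ⇑(T⁻¹ : MulAut G)) : Prop :=
  ∀ A : CSub G, IsCyclicCS A →
    ¬ ∃ n : ℕ → ℤ, UnboundedZ n ∧
        Tendsto (fun k => chabautyIter T hT hT' (n k) A) atTop (𝓝 (trivialCS G))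

/-- A family of homeomorphisms acts distally on a space: for distinct `x, y` the closure of
the orbit of `(x, y)` misses the diagonal. -/
def DistalFam {X : Type*} [TopologicalSpace X] {ι : Sort*} (F : ι → X → X) : Prop :=
  ∀ x y : X, x ≠ y → ∀ d : X, (d, d) ∉ closure (Set.range fun i => (F i x, F i y))

/-- A family of homeomorphisms preserving a subset `S` acts distally on `S`
(with its subspace topology). -/
def DistalFamOn {X : Type*} [TopologicalSpace X] {ι : Sort*} (S : Set X) (F : ι → X → X) :
    Prop :=
  ∀ x ∈ S, ∀ y ∈ S, x ≠ y → ∀ d ∈ S, (d, d) ∉ closure (Set.range fun i => (F i x, F i y))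

/-- **For a discrete finitely generated group all of whose subgroups are finitely generated,
the set of cyclic subgroups is closed in the Chabauty topology.** -/
theorem cyclic_subgroups_closed_of_all_subgroups_fg
    {G : Type*} [Group G] [TopologicalSpace G] [DiscreteTopology G]
    (hG : Group.FG G) (hsub : ∀ H : Subgroup G, H.FG) :
    IsClosed {A : CSub G | IsCyclicCS A} := by
  rw [← isOpen_compl_iff, isOpen_iff_mem_nhds]
  intro A hA
  obtain ⟨S, hS⟩ := hsub A.1
  have hopen : ∀ s : G, IsOpen {B : CSub G | s ∈ B.1} := fun s =>
    TopologicalSpace.isOpen_generateFrom_of_mem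
      (Or.inr ⟨{s}, isOpen_discrete _, by ext B; simp [Set.inter_singleton_nonempty]⟩)
  have hnhds : ∀ᶠ B : CSub G in 𝓝 A, ∀ s ∈ S, s ∈ B.1 :=
    (Filter.eventually_all_finset S).2 fun s hs =>
      (hopen s).mem_nhds (hS ▸ Subgroup.subset_closure hs : s ∈ A.1)
  filter_upwards [hnhds] with B hB
  rintro ⟨g, hg⟩
  have hle : A.1 ≤ Subgroup.zpowers g := by
    rw [← hS, ← hg, Subgroup.closure_le]
    exact hB
  have : IsCyclic A.1 :=
    isCyclic_of_injective (Subgroup.inclusion hle) (Subgroup.inclusion_injective hle)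
  obtain ⟨a, ha⟩ := (Subgroup.isCyclic_iff_exists_zpowers_eq_top A.1).1 this
  exact hA ⟨a, ha.symm⟩
end

section
/- Let G be a discrete group such that for every g ∈ G the set R_g of roots of g in G is finite. Then Sub^c_G is closed in Sub_G with respect to the Chabauty topology. In particular, if G is a strongly root compact discrete group, then Sub^c_G is closed in Sub_G. -/
open Topology Pointwise Filter

variable {G : Type*} [Group G] [TopologicalSpace G]

/-- A locally compact group is *strongly root compact* if for every compact `C ⊆ G` there is a
compact `C₀ ⊆ G` such that for every `n`, every finite sequence `x_1, …, x_n` with `x_n = e`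
satisfying `C x_i C x_j ∩ C x_{i+j} ≠ ∅` for all `i + j ≤ n` is contained in `C₀`. -/
def StronglyRootCompact (G : Type*) [Group G] [TopologicalSpace G] : Prop :=
  ∀ C : Set G, IsCompact C → ∃ C₀ : Set G, IsCompact C₀ ∧
    ∀ (n : ℕ) (x : ℕ → G), 0 < n → x n = 1 →
      (∀ i j : ℕ, 1 ≤ i → 1 ≤ j → i + j ≤ n →
        ((C * {x i} * C * {x j}) ∩ (C * {x (i + j)})).Nonempty) →
      ∀ i : ℕ, 1 ≤ i → i ≤ n → x i ∈ C₀

theorem CSub.isOpen_mem [DiscreteTopology G] (g : G) : IsOpen {A : CSub G | g ∈ A.1} := by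
  apply TopologicalSpace.isOpen_generateFrom_of_mem
  refine Or.inr ⟨{g}, isOpen_discrete _, ?_⟩
  ext A
  simp

theorem CSub.isOpen_notMem (g : G) : IsOpen {A : CSub G | g ∉ A.1} := by
  apply TopologicalSpace.isOpen_generateFrom_of_mem
  refine Or.inl ⟨{g}, isCompact_singleton, ?_⟩
  ext A
  simp

theorem CSub.isClosed_singleton [DiscreteTopology G] (A : CSub G) :
    IsClosed ({A} : Set (CSub G)) := by
  have h : ({A} : Set (CSub G)) =
      ⋂ g : G, {B : CSub G | g ∈ B.1 ↔ g ∈ A.1} := by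
    ext B
    simp only [Set.mem_singleton_iff, Set.mem_iInter, Set.mem_ofPred_eq]
    exact ⟨fun h => by simp [h], fun h => Subtype.ext (Subgroup.ext h)⟩
  rw [h]
  refine isClosed_iInter fun g => ⟨?_⟩
  by_cases hg : g ∈ A.1
  · simpa [hg, Set.compl_ofPred] using CSub.isOpen_notMem g
  · simpa [hg, Set.compl_ofPred] using CSub.isOpen_mem g

theorem exists_root_generator {H : Type*} [Group H] {x g : H} (hg : g ≠ 1) (h : g ∈ Subgroup.zpowers x) :
    ∃ y, (∃ n : ℕ, 0 < n ∧ y ^ n = g) ∧ Subgroup.zpowers y = Subgroup.zpowers x := by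
  obtain ⟨k, rfl⟩ := Subgroup.mem_zpowers_iff.1 h
  have hk : 0 < k.natAbs := Int.natAbs_pos.2 fun h0 => hg (by simp [h0])
  rcases Int.natAbs_eq k with h' | h'
  · exact ⟨x, ⟨k.natAbs, hk, by rw [← zpow_natCast, ← h']⟩, rfl⟩
  · refine ⟨x⁻¹, ⟨k.natAbs, hk, ?_⟩, Subgroup.zpowers_inv⟩
    rw [← zpow_natCast, inv_zpow', ← h']

theorem isClosed_isCyclicCS_of_finite_roots [DiscreteTopology G]
    (hfin : ∀ g : G, {x : G | ∃ n : ℕ, 0 < n ∧ x ^ n = g}.Finite) :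
    IsClosed {A : CSub G | IsCyclicCS A} := by
  refine isClosed_of_closure_subset fun A hA => ?_
  by_cases hbot : A.1 = ⊥
  · exact ⟨1, by simp [hbot]⟩
  obtain ⟨g, hgA, hg⟩ := A.1.bot_or_exists_ne_one.resolve_left hbot
  let F : Set (CSub G) := (fun x => ⟨Subgroup.zpowers x, isClosed_discrete _⟩) ''
    {x : G | ∃ n : ℕ, 0 < n ∧ x ^ n = g}
  have hF : IsClosed F := by
    rw [← Set.biUnion_of_singleton F]
    exact ((hfin g).image _).isClosed_biUnion fun B _ => CSub.isClosed_singleton B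
  have hAF : A ∈ F := by
    rw [← hF.closure_eq]
    refine closure_mono ?_ ((CSub.isOpen_mem g).inter_closure ⟨hgA, hA⟩)
    rintro B ⟨hgB, x, hx⟩
    obtain ⟨y, hy, hyx⟩ := exists_root_generator hg (hx.le hgB)
    exact ⟨y, hy, Subtype.ext (hyx.trans hx.symm)⟩
  obtain ⟨x, -, rfl⟩ := hAF
  exact ⟨x, rfl⟩

theorem StronglyRootCompact.finite_roots [DiscreteTopology G] (hG : StronglyRootCompact G)
    (g : G) : {x : G | ∃ n : ℕ, 0 < n ∧ x ^ n = g}.Finite := by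
  obtain ⟨C₀, hC₀, h⟩ := hG {1, g} (Set.toFinite _).isCompact
  refine (hC₀.finite_of_discrete.insert g).subset ?_
  rintro x ⟨n, hn, hx⟩
  rcases (show n = 1 ∨ 1 < n by omega) with rfl | hn1
  · simp_all
  right
  have key := h n (fun i => if i = n then 1 else x ^ i) hn (by simp) ?_ 1 le_rfl hn
  · simpa [hn1.ne] using key
  intro i j hi hj hij
  have hin : i ≠ n := by omega
  have hjn : j ≠ n := by omega
  have h1 : (1 : G) ∈ ({1, g} : Set G) := by simp
  refine ⟨x ^ (i + j), ?_, ?_⟩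
  · have := Set.mul_mem_mul (Set.mul_mem_mul (Set.mul_mem_mul h1
      (Set.mem_singleton (x ^ i))) h1) (Set.mem_singleton (x ^ j))
    simpa only [if_neg hin, if_neg hjn, one_mul, mul_one, ← pow_add] using this
  · by_cases hs : i + j = n
    · simp [hs, hx]
    · simp [hs]

/-- **For a discrete group in which every element has only finitely many roots, the set of
cyclic subgroups is Chabauty-closed; in particular this holds for strongly root compact
discrete groups.** -/
theorem cyclic_subgroups_closed_of_finite_roots
    {G : Type*} [Group G] [TopologicalSpace G] [DiscreteTopology G] :
    ((∀ g : G, {x : G | ∃ n : ℕ, 0 < n ∧ x ^ n = g}.Finite) →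
      IsClosed {A : CSub G | IsCyclicCS A}) ∧
    (StronglyRootCompact G → IsClosed {A : CSub G | IsCyclicCS A}) := by
  exact ⟨isClosed_isCyclicCS_of_finite_roots,
    fun hG => isClosed_isCyclicCS_of_finite_roots hG.finite_roots⟩
end
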